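/- Let n ≥ 1, let L > 0, let 0 < α < 1/L, and let f : ℝ^n → ℝ be convex, continuously differentiable, and L-smooth relative to h(x) = Σ_i x_i log x_i on S. Let I ⊆ {1,...,n} be nonempty and set S_I = {x ∈ S : x_i = 0 for all i ∉ I}. Let x^0 ∈ S_I with x^0_i > 0 for all i ∈ I, and for each k ≥ 0 let x^{k+1} be the minimizer over S_I of the function z ↦ ⟨∇f(x^k), z⟩ + (1/α) D(z, x^k). Then the sequence (x^k) converges to a point x* ∈ S_I satisfying f(x*) = min{f(x) : x ∈ S_I}. -/

import Mathlib

open Finset Filter Topology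

noncomputable def klS (a b : ℝ) : ℝ := if a = 0 then b else a * Real.log (a / b) - a + b

noncomputable def kl {n : ℕ} (x y : Fin n → ℝ) : ℝ := ∑ i, klS (x i) (y i)

def probSimplex (n : ℕ) : Set (Fin n → ℝ) := {x | (∑ i, x i) = 1 ∧ ∀ i, 0 ≤ x i}

noncomputable def suppF {n : ℕ} (x : Fin n → ℝ) : Finset (Fin n) :=
  Finset.univ.filter (fun i => x i ≠ 0)

noncomputable def l0 {n : ℕ} (x : Fin n → ℝ) : ℕ := (suppF x).card

theorem klS_eq {a b : ℝ} (hb : 0 < b) :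
    klS a b = a * Real.log a - a * Real.log b - a + b := by
  unfold klS
  split_ifs with h
  · simp [h]
  · rw [Real.log_div h hb.ne']
    ring

theorem klS_zero_zero : klS 0 0 = 0 := by simp [klS]

theorem klS_self (a : ℝ) : klS a a = 0 := by
  by_cases h : a = 0 <;> simp [klS, h]

/-- The scalar divergence dominates the squared Hellinger distance. -/
theorem sq_sqrt_sub_sqrt_le_klS {a b : ℝ} (ha : 0 ≤ a) (hb : 0 < b) :
    (√a - √b) ^ 2 ≤ klS a b := by
  rcases ha.eq_or_lt with rfl | ha
  · simp [klS, Real.sq_sqrt hb.le]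
  · have hsa := Real.sqrt_pos.2 ha
    have hsb := Real.sqrt_pos.2 hb
    have hlog := Real.log_le_sub_one_of_pos (div_pos hsb hsa)
    rw [Real.log_div hsb.ne' hsa.ne', Real.log_sqrt hb.le, Real.log_sqrt ha.le] at hlog
    have hmul := mul_le_mul_of_nonneg_left hlog ha.le
    have hab : a * (√b / √a - 1) = √a * √b - a := by
      rw [mul_sub, mul_one, mul_div_assoc', mul_comm a, mul_div_assoc, Real.div_sqrt, mul_comm]
    rw [hab] at hmul
    rw [klS_eq hb]
    nlinarith [Real.sq_sqrt ha.le, Real.sq_sqrt hb.le]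

theorem tendsto_klS_self {u : ℕ → ℝ} {a : ℝ} (h : Tendsto u atTop (𝓝 a)) :
    Tendsto (fun k => klS a (u k)) atTop (𝓝 0) := by
  by_cases ha : a = 0
  · simpa [klS, ha] using h
  · have hlog := (tendsto_const_nhds (x := a)).div h ha
    rw [div_self ha] at hlog
    have hlim := (((Real.continuousAt_log one_ne_zero).tendsto.comp hlog).const_mul a).sub_const a
      |>.add h
    simpa [klS, ha, Function.comp_def] using hlim

/-- The face of the simplex of points supported in `I`. -/
def simplexFace {n : ℕ} (I : Finset (Fin n)) : Set (Fin n → ℝ) :=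
  {x | x ∈ probSimplex n ∧ ∀ i ∉ I, x i = 0}

/-- The relative interior of the face of the simplex of points supported in `I`. -/
def simplexFaceInterior {n : ℕ} (I : Finset (Fin n)) : Set (Fin n → ℝ) :=
  {x | x ∈ simplexFace I ∧ ∀ i ∈ I, 0 < x i}

section

variable {n : ℕ} {I : Finset (Fin n)}

theorem isCompact_simplexFace (I : Finset (Fin n)) : IsCompact (simplexFace I) := by
  have hS : probSimplex n = stdSimplex ℝ (Fin n) := by
    ext x
    simp [probSimplex, stdSimplex, and_comm]
  have hclosed : IsClosed {x : Fin n → ℝ | ∀ i ∉ I, x i = 0} := by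
    simp only [Set.ofPred_forall]
    exact isClosed_iInter fun i => isClosed_iInter fun _ =>
      isClosed_eq (continuous_apply i) continuous_const
  have hface : simplexFace I = stdSimplex ℝ (Fin n) ∩ {x | ∀ i ∉ I, x i = 0} := by
    rw [← hS]
    rfl
  rw [hface]
  exact (isCompact_stdSimplex ℝ (Fin n)).inter_right hclosed

theorem kl_self (x : Fin n → ℝ) : kl x x = 0 := by simp [kl, klS_self]

theorem sq_sqrt_sub_sqrt_le_klS_apply {x y : Fin n → ℝ} (hx : x ∈ simplexFace I)
    (hy : y ∈ simplexFaceInterior I) (i : Fin n) : (√(x i) - √(y i)) ^ 2 ≤ klS (x i) (y i) := by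
  by_cases hi : i ∈ I
  · exact sq_sqrt_sub_sqrt_le_klS (hx.1.2 i) (hy.2 i hi)
  · simp [hx.2 i hi, hy.1.2 i hi, klS_zero_zero]

theorem sq_sqrt_sub_sqrt_le_kl {x y : Fin n → ℝ} (hx : x ∈ simplexFace I)
    (hy : y ∈ simplexFaceInterior I) (i : Fin n) : (√(x i) - √(y i)) ^ 2 ≤ kl x y :=
  (sq_sqrt_sub_sqrt_le_klS_apply hx hy i).trans <|
    Finset.single_le_sum (f := fun j => klS (x j) (y j))
      (fun j _ => (sq_nonneg _).trans (sq_sqrt_sub_sqrt_le_klS_apply hx hy j)) (Finset.mem_univ i)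

theorem kl_nonneg {x y : Fin n → ℝ} (hx : x ∈ simplexFace I) (hy : y ∈ simplexFaceInterior I) :
    0 ≤ kl x y :=
  Finset.sum_nonneg fun j _ => (sq_nonneg _).trans (sq_sqrt_sub_sqrt_le_klS_apply hx hy j)

theorem eq_of_kl_nonpos {x y : Fin n → ℝ} (hx : x ∈ simplexFace I)
    (hy : y ∈ simplexFaceInterior I) (h : kl x y ≤ 0) : x = y := by
  ext i
  have h0 : √(x i) - √(y i) = 0 :=
    pow_eq_zero_iff two_ne_zero |>.1 <|
      le_antisymm ((sq_sqrt_sub_sqrt_le_kl hx hy i).trans h) (sq_nonneg _)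
  exact (Real.sqrt_inj (hx.1.2 i) (hy.1.1.2 i)).1 (sub_eq_zero.1 h0)

theorem tendsto_of_tendsto_kl {u : ℕ → Fin n → ℝ} {x : Fin n → ℝ} (hx : x ∈ simplexFace I)
    (hu : ∀ k, u k ∈ simplexFaceInterior I) (h : Tendsto (fun k => kl x (u k)) atTop (𝓝 0)) :
    Tendsto u atTop (𝓝 x) := by
  refine tendsto_pi_nhds.2 fun i => ?_
  have hsq : Tendsto (fun k => (√(x i) - √(u k i)) ^ 2) atTop (𝓝 0) :=
    squeeze_zero (fun _ => sq_nonneg _) (fun k => sq_sqrt_sub_sqrt_le_kl hx (hu k) i) h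
  have habs : Tendsto (fun k => |√(x i) - √(u k i)|) atTop (𝓝 0) := by
    simpa [Real.sqrt_sq_eq_abs] using hsq.sqrt
  have hsub := (tendsto_zero_iff_abs_tendsto_zero _).2 habs
  have hsqrt := ((tendsto_const_nhds (x := √(x i))).sub hsub).pow 2
  simpa [Real.sq_sqrt (hx.1.2 i), fun k => Real.sq_sqrt ((hu k).1.1.2 i)] using hsqrt

theorem tendsto_kl_self {u : ℕ → Fin n → ℝ} {x : Fin n → ℝ} (h : Tendsto u atTop (𝓝 x)) :
    Tendsto (fun k => kl x (u k)) atTop (𝓝 0) := by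
  have := tendsto_finsetSum (Finset.univ : Finset (Fin n)) fun i _ =>
    tendsto_klS_self (tendsto_pi_nhds.1 h i)
  simpa [kl] using this

/-- A KL proximal step minimizes a KL divergence, up to an additive constant. -/
theorem exists_kl_eq_kl_add_linear (hI : I.Nonempty) {w : Fin n → ℝ}
    (hw : w ∈ simplexFaceInterior I) (g : (Fin n → ℝ) →L[ℝ] ℝ) (α : ℝ) :
    ∃ y ∈ simplexFaceInterior I, ∃ c : ℝ, ∀ z ∈ simplexFace I,
      kl z y = kl z w + α * g z + c := by
  set e : Fin n → ℝ := fun i => w i * Real.exp (-(α * g (Pi.single i 1))) with he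
  have he_pos : ∀ i ∈ I, 0 < e i := fun i hi => mul_pos (hw.2 i hi) (Real.exp_pos _)
  have he_zero : ∀ i ∉ I, e i = 0 := fun i hi => by simp [he, hw.1.2 i hi]
  have he_nonneg : ∀ i, 0 ≤ e i := fun i => mul_nonneg (hw.1.1.2 i) (Real.exp_pos _).le
  set Z : ℝ := ∑ i, e i
  have hZ_pos : 0 < Z := by
    obtain ⟨i, hi⟩ := hI
    exact Finset.sum_pos' (fun i _ => he_nonneg i) ⟨i, Finset.mem_univ i, he_pos i hi⟩
  have hy_sum : ∑ i, e i / Z = 1 := by rw [← Finset.sum_div, div_self hZ_pos.ne']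
  refine ⟨fun i => e i / Z, ⟨⟨⟨hy_sum, fun i => div_nonneg (he_nonneg i) hZ_pos.le⟩,
    fun i hi => by simp [he_zero i hi]⟩, fun i hi => div_pos (he_pos i hi) hZ_pos⟩,
    Real.log Z, fun z hz => ?_⟩
  have hg : g z = ∑ i, z i * g (Pi.single i 1) := by
    conv_lhs => rw [← Finset.univ_sum_single z, map_sum]
    refine Finset.sum_congr rfl fun i _ => ?_
    rw [← smul_eq_mul, ← map_smul, ← Pi.single_smul, smul_eq_mul, mul_one]
  have hterm : ∀ i, klS (z i) (e i / Z) = klS (z i) (w i) + α * (z i * g (Pi.single i 1))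
      + z i * Real.log Z + (e i / Z - w i) := by
    intro i
    by_cases hi : i ∈ I
    · rw [klS_eq (div_pos (he_pos i hi) hZ_pos), klS_eq (hw.2 i hi),
        Real.log_div (he_pos i hi).ne' hZ_pos.ne', he,
        Real.log_mul (hw.2 i hi).ne' (Real.exp_pos _).ne', Real.log_exp]
      ring
    · simp [hz.2 i hi, he_zero i hi, hw.1.2 i hi, klS_zero_zero]
  rw [kl, Finset.sum_congr rfl fun i _ => hterm i, Finset.sum_add_distrib, Finset.sum_add_distrib,
    Finset.sum_add_distrib, Finset.sum_sub_distrib, hy_sum, hw.1.1.1, ← Finset.mul_sum, ← hg,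
    ← Finset.sum_mul, hz.1.1, kl]
  ring

/-- A KL proximal step stays in the relative interior and satisfies the three-point identity. -/
theorem kl_prox_three_point (hI : I.Nonempty) {w x : Fin n → ℝ}
    (hw : w ∈ simplexFaceInterior I) (hx : x ∈ simplexFace I) (g : (Fin n → ℝ) →L[ℝ] ℝ)
    {α : ℝ} (hα : 0 < α)
    (hmin : ∀ z ∈ simplexFace I, g x + 1 / α * kl x w ≤ g z + 1 / α * kl z w) :
    x ∈ simplexFaceInterior I ∧
      ∀ z ∈ simplexFace I, α * g x + kl x w + kl z x = α * g z + kl z w := by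
  obtain ⟨y, hy, c, hc⟩ := exists_kl_eq_kl_add_linear hI hw g α
  have hscale : ∀ r s : ℝ, α * (r + 1 / α * s) = α * r + s := fun r s => by field_simp
  have hxy : x = y := by
    refine eq_of_kl_nonpos hx hy ?_
    have h := mul_le_mul_of_nonneg_left (hmin y hy.1) hα.le
    rw [hscale, hscale] at h
    have hyy := hc y hy.1
    rw [kl_self] at hyy
    linarith [hc x hx]
  subst hxy
  refine ⟨hy, fun z hz => ?_⟩
  have hxx := hc x hx
  rw [kl_self] at hxx
  linarith [hc z hz]

theorem ConvexOn.add_fderiv_sub_le {E : Type*} [NormedAddCommGroup E] [NormedSpace ℝ E]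
    {f : E → ℝ} (hconv : ConvexOn ℝ Set.univ f) {w : E} (hf : DifferentiableAt ℝ f w) (z : E) :
    f w + fderiv ℝ f w (z - w) ≤ f z := by
  have hφ := hconv.comp_affineMap (AffineMap.lineMap w z)
  have hderiv : HasDerivAt (f ∘ AffineMap.lineMap w z) (fderiv ℝ f w (z - w)) (0 : ℝ) := by
    refine HasFDerivAt.comp_hasDerivAt (0 : ℝ) ?_ AffineMap.hasDerivAt_lineMap
    simpa using hf.hasFDerivAt
  have h := hφ.le_slope_of_hasDerivAt (x := 0) (y := 1) (by simp) (by simp) one_pos hderiv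
  simp only [slope_def_field, Function.comp_apply, AffineMap.lineMap_apply_one,
    AffineMap.lineMap_apply_zero, sub_zero, div_one] at h
  linarith

/-- One step of the KL proximal gradient method decreases the divergence to `z` by at least
`α * (f x - f z)`. -/
theorem kl_prox_descent {L α : ℝ} (hL : 0 < L) (hα0 : 0 < α) (hαL : α < 1 / L)
    {f : (Fin n → ℝ) → ℝ} (hconv : ConvexOn ℝ Set.univ f) {w x z : Fin n → ℝ}
    (hf : DifferentiableAt ℝ f w) (hw : w ∈ simplexFaceInterior I) (hx : x ∈ simplexFace I)
    (hsmooth : f x ≤ f w + fderiv ℝ f w (x - w) + L * kl x w)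
    (hthree : α * fderiv ℝ f w x + kl x w + kl z x = α * fderiv ℝ f w z + kl z w) :
    α * (f x - f z) ≤ kl z w - kl z x := by
  have hgrad := hconv.add_fderiv_sub_le hf z
  rw [map_sub] at hsmooth hgrad
  have hαL' : α * L ≤ 1 := ((lt_div_iff₀ hL).1 hαL).le
  have hkl := mul_le_mul_of_nonneg_right hαL' (kl_nonneg hx hw)
  have h := mul_le_mul_of_nonneg_left (add_le_add hsmooth hgrad) hα0.le
  nlinarith

end

/-- the Bregman proximal gradient iterates on the support-restricted
simplex converge to a minimizer of f over that set. -/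
theorem stmt_10 (n : ℕ) (hn : 1 ≤ n) (L α : ℝ) (hL : 0 < L) (hα0 : 0 < α) (hαL : α < 1 / L)
    (f : (Fin n → ℝ) → ℝ) (hconv : ConvexOn ℝ Set.univ f) (hf : ContDiff ℝ 1 f)
    (hsmooth : ∀ z ∈ probSimplex n, ∀ w ∈ probSimplex n, suppF z ⊆ suppF w →
      f z ≤ f w + fderiv ℝ f w (z - w) + L * kl z w)
    (I : Finset (Fin n)) (hI : I.Nonempty)
    (X : ℕ → Fin n → ℝ)
    (hX0 : X 0 ∈ probSimplex n) (hX0I : ∀ i ∉ I, X 0 i = 0) (hX0pos : ∀ i ∈ I, 0 < X 0 i)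
    (hXmem : ∀ k, X (k + 1) ∈ probSimplex n) (hXI : ∀ k, ∀ i ∉ I, X (k + 1) i = 0)
    (hXmin : ∀ k, ∀ z ∈ probSimplex n, (∀ i ∉ I, z i = 0) →
      fderiv ℝ f (X k) (X (k + 1)) + (1 / α) * kl (X (k + 1)) (X k) ≤
      fderiv ℝ f (X k) z + (1 / α) * kl z (X k)) :
    ∃ xstar : Fin n → ℝ, xstar ∈ probSimplex n ∧ (∀ i ∉ I, xstar i = 0) ∧
      (∀ z ∈ probSimplex n, (∀ i ∉ I, z i = 0) → f xstar ≤ f z) ∧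
      Tendsto X atTop (nhds xstar) := by
  have hint : ∀ k, X k ∈ simplexFaceInterior I := by
    intro k
    induction k with
    | zero => exact ⟨⟨hX0, hX0I⟩, hX0pos⟩
    | succ k ih =>
      exact (kl_prox_three_point hI ih ⟨hXmem k, hXI k⟩ _ hα0
        fun z hz => hXmin k z hz.1 hz.2).1
  have hdescent : ∀ z ∈ simplexFace I, ∀ k,
      α * (f (X (k + 1)) - f z) ≤ kl z (X k) - kl z (X (k + 1)) := by
    intro z hz k
    refine kl_prox_descent hL hα0 hαL hconv (hf.differentiable one_ne_zero _) (hint k)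
      (hint (k + 1)).1 (hsmooth _ (hXmem k) _ (hint k).1.1 fun i hi => ?_)
      ((kl_prox_three_point hI (hint k) (hint (k + 1)).1 _ hα0
        fun z hz => hXmin k z hz.1 hz.2).2 z hz)
    simp only [suppF, Finset.mem_filter, Finset.mem_univ, true_and] at hi ⊢
    exact ((hint k).2 i (by_contra fun h => hi (hXI k i h))).ne'
  obtain ⟨m, hm, hmin⟩ := (isCompact_simplexFace I).exists_isMinOn ⟨X 0, (hint 0).1⟩
    hf.continuous.continuousOn
  have hlim : ∀ z ∈ simplexFace I, (∀ y ∈ simplexFace I, f z ≤ f y) →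
      ∃ l, Tendsto (fun k => kl z (X k)) atTop (𝓝 l) := by
    intro z hz hzmin
    have hanti : Antitone fun k => kl z (X k) := antitone_nat_of_succ_le fun k => by
      have := mul_nonneg hα0.le (sub_nonneg.2 (hzmin _ (hint (k + 1)).1))
      linarith [hdescent z hz k]
    exact ⟨_, tendsto_atTop_ciInf hanti
      ⟨0, by rintro _ ⟨k, rfl⟩; exact kl_nonneg hz (hint k)⟩⟩
  have hval : Tendsto (fun k => f (X k)) atTop (𝓝 (f m)) := by
    obtain ⟨l, hl⟩ := hlim m hm fun y hy => hmin hy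
    have hdiff := hl.sub (hl.comp (tendsto_add_atTop_nat 1))
    rw [sub_self] at hdiff
    have hgap := squeeze_zero
      (fun k => mul_nonneg hα0.le (sub_nonneg.2 (hmin (hint (k + 1)).1)))
      (hdescent m hm) hdiff
    have hval' := (hgap.const_mul α⁻¹).add_const (f m)
    simp only [inv_mul_cancel_left₀ hα0.ne', sub_add_cancel, mul_zero, zero_add] at hval'
    exact (tendsto_add_atTop_iff_nat 1).1 hval'
  obtain ⟨x, hx, φ, hφ, hXφ⟩ := (isCompact_simplexFace I).tendsto_subseq fun k => (hint k).1
  have hfx : f x = f m :=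
    tendsto_nhds_unique ((hf.continuous.tendsto x).comp hXφ) (hval.comp hφ.tendsto_atTop)
  have hxmin : ∀ y ∈ simplexFace I, f x ≤ f y := fun y hy => hfx.trans_le (hmin hy)
  refine ⟨x, hx.1, hx.2, fun z hz hzI => hxmin z ⟨hz, hzI⟩, tendsto_of_tendsto_kl hx hint ?_⟩
  obtain ⟨l, hl⟩ := hlim x hx hxmin
  rwa [tendsto_nhds_unique (hl.comp hφ.tendsto_atTop) (tendsto_kl_self hXφ)] at hl
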